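/- arXiv:2107.05391 — 2 statements merged into one kernel-verified Lean document; each statement's English description precedes it below -/
import Mathlib

section
/- If P is a Killing vector field of g (that is, g(∇_X P, Y) + g(∇_Y P, X) = 0 for all vector fields X, Y), then for all vector fields Y, Z: Ŝ(Y,Z) = S(Y,Z) + (n−2)·π(Y)π(Z) − (n−2)·g(P,P)·g(Y,Z). -/
open scoped BigOperators

/-! Setup: an open set `U ⊆ ℝⁿ` with a Riemannian metric given by component functions
`g x i j`, the Levi-Civita connection computed from the Christoffel symbols, the
semi-symmetric metric connection `∇̄_X Y = ∇_X Y + π(Y)X − g(X,Y)P`, curvature and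
Ricci tensors of a connection, and covariant derivatives of `(0,2)`-tensors. -/

/-- A vector field on (an open subset of) `ℝⁿ`. -/
abbrev VF (n : ℕ) := (Fin n → ℝ) → Fin n → ℝ

/-- Partial derivative `∂ᵢ f` of a real-valued function. -/
noncomputable def pd {n : ℕ} (i : Fin n) (f : (Fin n → ℝ) → ℝ) (x : Fin n → ℝ) : ℝ :=
  fderiv ℝ f x (Pi.single i 1)

/-- The metric evaluated on two tangent vectors at the point `x`. -/
def gval {n : ℕ} (g : (Fin n → ℝ) → Fin n → Fin n → ℝ) (x v w : Fin n → ℝ) : ℝ :=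
  ∑ i, ∑ j, g x i j * v i * w j

/-- The Christoffel symbols `Γ^k_{ij} = ½ g^{kl}(∂ᵢ g_{jl} + ∂ⱼ g_{il} − ∂_l g_{ij})`. -/
noncomputable def christoffel {n : ℕ} (g : (Fin n → ℝ) → Fin n → Fin n → ℝ)
    (x : Fin n → ℝ) (k i j : Fin n) : ℝ :=
  (1 / 2) * ∑ l, (Matrix.of (g x))⁻¹ k l *
    (pd i (fun y => g y j l) x + pd j (fun y => g y i l) x - pd l (fun y => g y i j) x)

/-- The Levi-Civita covariant derivative `(∇_X Y)^k = X^i ∂ᵢ Y^k + Γ^k_{ij} X^i Y^j`. -/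
noncomputable def lcCov {n : ℕ} (g : (Fin n → ℝ) → Fin n → Fin n → ℝ)
    (X Y : VF n) (x : Fin n → ℝ) : Fin n → ℝ :=
  fun k => fderiv ℝ (fun y => Y y k) x (X x) +
    ∑ i, ∑ j, christoffel g x k i j * X x i * Y x j

/-- The semi-symmetric metric connection `∇̄_X Y = ∇_X Y + π(Y)X − g(X,Y)P`,
where `π(X) = g(X,P)`. -/
noncomputable def ssCov {n : ℕ} (g : (Fin n → ℝ) → Fin n → Fin n → ℝ)
    (P : VF n) (X Y : VF n) (x : Fin n → ℝ) : Fin n → ℝ :=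
  fun k => lcCov g X Y x k + gval g x (Y x) (P x) * X x k - gval g x (X x) (Y x) * P x k

/-- The Lie bracket of vector fields. -/
noncomputable def lie {n : ℕ} (X Y : VF n) (x : Fin n → ℝ) : Fin n → ℝ :=
  fun k => fderiv ℝ (fun y => Y y k) x (X x) - fderiv ℝ (fun y => X y k) x (Y x)

/-- The curvature `R_D(X,Y)Z = D_X D_Y Z − D_Y D_X Z − D_{[X,Y]}Z` of a connection `D`. -/
noncomputable def curv {n : ℕ} (D : VF n → VF n → VF n) (X Y Z : VF n)
    (x : Fin n → ℝ) : Fin n → ℝ :=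
  fun k => D X (D Y Z) x k - D Y (D X Z) x k - D (lie X Y) Z x k

/-- The Ricci tensor `Ric_D(Y,Z) = trace (X ↦ R_D(X,Y)Z)` of a connection `D`
(the trace computed in the coordinate frame). -/
noncomputable def ricci {n : ℕ} (D : VF n → VF n → VF n) (Y Z : VF n)
    (x : Fin n → ℝ) : ℝ :=
  ∑ i, curv D (fun _ => Pi.single i 1) Y Z x i

/-- The symmetrization `Ŝ(Y,Z) = ½(S̄(Y,Z) + S̄(Z,Y))` of the Ricci tensor of the
semi-symmetric metric connection. -/
noncomputable def shat {n : ℕ} (g : (Fin n → ℝ) → Fin n → Fin n → ℝ)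
    (P : VF n) (Y Z : VF n) (x : Fin n → ℝ) : ℝ :=
  (ricci (ssCov g P) Y Z x + ricci (ssCov g P) Z Y x) / 2

/-- The covariant derivative `(D_X T)(Y,Z) = X(T(Y,Z)) − T(D_X Y, Z) − T(Y, D_X Z)` of a
`(0,2)`-tensor `T` along the connection `D`. -/
noncomputable def covT {n : ℕ} (D : VF n → VF n → VF n)
    (T : VF n → VF n → (Fin n → ℝ) → ℝ) (X Y Z : VF n) (x : Fin n → ℝ) : ℝ :=
  fderiv ℝ (T Y Z) x (X x) - T (D X Y) Z x - T Y (D X Z) x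

/-- Smoothness of a vector-field/metric-type map on `U`. -/
def SmoothVF {n : ℕ} {E : Type*} [NormedAddCommGroup E] [NormedSpace ℝ E]
    (U : Set (Fin n → ℝ)) (f : (Fin n → ℝ) → E) : Prop :=
  ContDiffOn ℝ (⊤ : ℕ∞) f U


/-- General connection with coefficients `C`. -/
noncomputable def conn {n : ℕ} (C : (Fin n → ℝ) → Fin n → Fin n → Fin n → ℝ)
    (X Y : VF n) (x : Fin n → ℝ) : Fin n → ℝ :=
  fun k => fderiv ℝ (fun y => Y y k) x (X x) + ∑ i, ∑ j, C x k i j * X x i * Y x j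

lemma lcCov_eq {n : ℕ} (g : (Fin n → ℝ) → Fin n → Fin n → ℝ) :
    lcCov g = conn (christoffel g) := rfl

/-- The coefficients of the semi-symmetric connection. -/
noncomputable def ssC {n : ℕ} (g : (Fin n → ℝ) → Fin n → Fin n → ℝ) (P : VF n)
    (x : Fin n → ℝ) (k i j : Fin n) : ℝ :=
  christoffel g x k i j + (if k = i then ∑ m, g x j m * P x m else 0) - g x i j * P x k

lemma ssCov_eq {n : ℕ} (g : (Fin n → ℝ) → Fin n → Fin n → ℝ) (P : VF n) :
    ssCov g P = conn (ssC g P) := by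
  funext X Y x k
  simp only [ssCov, conn, ssC, lcCov, gval, add_mul, sub_mul, Finset.sum_add_distrib,
    Finset.sum_sub_distrib, ite_mul, zero_mul, Finset.sum_mul]
  have h1 : ∑ i, ∑ j, (if k = i then (∑ m, g x j m * P x m * X x i * Y x j) else 0)
      = ∑ i, ∑ j, g x i j * Y x i * P x j * X x k := by
    rw [Finset.sum_comm]
    refine Finset.sum_congr rfl fun j _ => ?_
    rw [Finset.sum_ite_eq]
    simp only [Finset.mem_univ, if_true]
    exact Finset.sum_congr rfl fun m _ => by ring
  have h2 : ∑ i, ∑ j, g x i j * X x i * Y x j * P x k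
     = ∑ i, ∑ j, g x i j * P x k * X x i * Y x j :=
    Finset.sum_congr rfl fun m _ => Finset.sum_congr rfl fun m _ => by ring
  rw [h1, h2]; ring

lemma dd {n : ℕ} (f : (Fin n → ℝ) → ℝ) (Y : VF n) (x v : Fin n → ℝ)
    (hf : ContDiffAt ℝ 2 f x) (hY : DifferentiableAt ℝ Y x) :
    DifferentiableAt ℝ (fun y => fderiv ℝ f y (Y y)) x ∧
    fderiv ℝ (fun y => fderiv ℝ f y (Y y)) x v =
      fderiv ℝ (fderiv ℝ f) x v (Y x) + fderiv ℝ f x (fun k => fderiv ℝ (fun y => Y y k) x v) := by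
  have h1 : DifferentiableAt ℝ (fderiv ℝ f) x :=
    (hf.fderiv_right (m := 1) (by norm_num)).differentiableAt (by norm_num)
  refine ⟨h1.clm_apply hY, ?_⟩
  rw [fderiv_clm_apply h1 hY]
  have : (fun k => fderiv ℝ (fun y => Y y k) x v) = fderiv ℝ Y x v := by
    funext k
    rw [fderiv_pi (fun i => (differentiableAt_pi.1 hY i))]
    rfl
  rw [this]
  simp [add_comm]

lemma fd3 {n : ℕ} (a b c : (Fin n → ℝ) → ℝ) (x v : Fin n → ℝ)
    (ha : DifferentiableAt ℝ a x) (hb : DifferentiableAt ℝ b x) (hc : DifferentiableAt ℝ c x) :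
    fderiv ℝ (fun y => a y * b y * c y) x v =
      fderiv ℝ a x v * b x * c x + a x * fderiv ℝ b x v * c x + a x * b x * fderiv ℝ c x v := by
  rw [fderiv_fun_mul (ha.fun_mul hb) hc, fderiv_fun_mul ha hb]
  simp; ring

lemma fd_sum {n : ℕ} {ι : Type*} [Fintype ι] (a : ι → (Fin n → ℝ) → ℝ) (x v : Fin n → ℝ)
    (ha : ∀ i, DifferentiableAt ℝ (a i) x) :
    fderiv ℝ (fun y => ∑ i, a i y) x v = ∑ i, fderiv ℝ (a i) x v := by
  rw [fderiv_fun_sum (fun i _ => ha i)]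
  simp

/-- `D_X D_Y Z` -/
lemma conn_conn {n : ℕ} (C : (Fin n → ℝ) → Fin n → Fin n → Fin n → ℝ) (X Y Z : VF n)
    (x : Fin n → ℝ) (hC : ∀ k i j, DifferentiableAt ℝ (fun y => C y k i j) x)
    (hY : DifferentiableAt ℝ Y x) (hZ : ContDiffAt ℝ 2 Z x) (k : Fin n) :
    conn C X (conn C Y Z) x k =
      fderiv ℝ (fderiv ℝ (fun y => Z y k)) x (X x) (Y x) +
      fderiv ℝ (fun y => Z y k) x (fun k => fderiv ℝ (fun y => Y y k) x (X x)) +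
      (∑ i, ∑ j, fderiv ℝ (fun y => C y k i j) x (X x) * Y x i * Z x j) +
      (∑ i, ∑ j, C x k i j * fderiv ℝ (fun y => Y y i) x (X x) * Z x j) +
      (∑ i, ∑ j, C x k i j * Y x i * fderiv ℝ (fun y => Z y j) x (X x)) +
      (∑ i, ∑ j, C x k i j * X x i * fderiv ℝ (fun y => Z y j) x (Y x)) +
      (∑ i, ∑ j, C x k i j * X x i * ∑ p, ∑ q, C x j p q * Y x p * Z x q) := by
  have hZk : ∀ k, ContDiffAt ℝ 2 (fun y => Z y k) x := fun k => contDiffAt_pi.1 hZ k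
  have hZd : ∀ k, DifferentiableAt ℝ (fun y => Z y k) x :=
    fun k => (hZk k).differentiableAt (by norm_num)
  have hYd : ∀ k, DifferentiableAt ℝ (fun y => Y y k) x := differentiableAt_pi.1 hY
  obtain ⟨d1, d2⟩ := dd (fun y => Z y k) Y x (X x) (hZk k) hY
  have hp : ∀ i j, DifferentiableAt ℝ (fun y => C y k i j * Y y i * Z y j) x :=
    fun i j => ((hC k i j).mul (hYd i)).mul (hZd j)
  have hs : ∀ i, DifferentiableAt ℝ (fun y => ∑ j, C y k i j * Y y i * Z y j) x :=
    fun i => DifferentiableAt.fun_sum fun j _ => hp i j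
  have hss : DifferentiableAt ℝ (fun y => ∑ i, ∑ j, C y k i j * Y y i * Z y j) x :=
    DifferentiableAt.fun_sum fun j _ => hs j
  have key : fderiv ℝ (fun y => conn C Y Z y k) x (X x) =
      fderiv ℝ (fderiv ℝ (fun y => Z y k)) x (X x) (Y x) +
      fderiv ℝ (fun y => Z y k) x (fun k => fderiv ℝ (fun y => Y y k) x (X x)) +
      ∑ i, ∑ j, (fderiv ℝ (fun y => C y k i j) x (X x) * Y x i * Z x j +
       C x k i j * fderiv ℝ (fun y => Y y i) x (X x) * Z x j +
       C x k i j * Y x i * fderiv ℝ (fun y => Z y j) x (X x)) := by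
    simp only [conn]
    rw [fderiv_fun_add d1 hss, add_apply, d2, fd_sum _ _ _ hs]
    congr 1
    refine Finset.sum_congr rfl fun i _ => ?_
    rw [fd_sum _ _ _ (hp i)]
    exact Finset.sum_congr rfl fun j _ => fd3 _ _ _ _ _ (hC k i j) (hYd i) (hZd j)
  rw [conn, key]
  simp only [conn, mul_add, Finset.sum_add_distrib]
  ring

lemma curv_conn {n : ℕ} (C : (Fin n → ℝ) → Fin n → Fin n → Fin n → ℝ) (X Y Z : VF n)
    (x : Fin n → ℝ) (hC : ∀ k i j, DifferentiableAt ℝ (fun y => C y k i j) x)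
    (hX : DifferentiableAt ℝ X x)
    (hY : DifferentiableAt ℝ Y x) (hZ : ContDiffAt ℝ 2 Z x) (k : Fin n) :
    curv (conn C) X Y Z x k =
      (∑ i, ∑ j, fderiv ℝ (fun y => C y k i j) x (X x) * Y x i * Z x j) -
      (∑ i, ∑ j, fderiv ℝ (fun y => C y k i j) x (Y x) * X x i * Z x j) +
      (∑ i, ∑ j, C x k i j * X x i * ∑ p, ∑ q, C x j p q * Y x p * Z x q) -
      (∑ i, ∑ j, C x k i j * Y x i * ∑ p, ∑ q, C x j p q * X x p * Z x q) := by
  have hs : fderiv ℝ (fderiv ℝ (fun y => Z y k)) x (X x) (Y x) =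
      fderiv ℝ (fderiv ℝ (fun y => Z y k)) x (Y x) (X x) :=
    ((contDiffAt_pi.1 hZ k).isSymmSndFDerivAt (by simp)).eq _ _
  rw [curv, conn_conn C X Y Z x hC hY hZ, conn_conn C Y X Z x hC hX hZ, hs, conn]
  have hl : lie X Y x = (fun k => fderiv ℝ (fun y => Y y k) x (X x)) -
     (fun k => fderiv ℝ (fun y => X y k) x (Y x)) := rfl
  rw [hl, map_sub]
  simp only [Pi.sub_apply, mul_sub, sub_mul, Finset.sum_sub_distrib]
  ring

lemma fd_eq_pd {n : ℕ} (f : (Fin n → ℝ) → ℝ) (x v : Fin n → ℝ) :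
    fderiv ℝ f x v = ∑ i, v i * pd i f x := by
  conv_lhs => rw [← Finset.univ_sum_single v]
  rw [map_sum]
  refine Finset.sum_congr rfl fun i _ => ?_
  have : Pi.single i (v i) = v i • (Pi.single i 1 : Fin n → ℝ) := by
    rw [← Pi.single_smul]; simp
  rw [this, map_smul]; rfl

/-- Ricci components. -/
noncomputable def RicC {n : ℕ} (C : (Fin n → ℝ) → Fin n → Fin n → Fin n → ℝ)
    (x : Fin n → ℝ) (j l : Fin n) : ℝ :=
  ∑ i, pd i (fun y => C y i j l) x - ∑ i, pd j (fun y => C y i i l) x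
    + ∑ i, ∑ m, C x i i m * C x m j l - ∑ i, ∑ m, C x i j m * C x m i l

lemma ricci_conn {n : ℕ} (C : (Fin n → ℝ) → Fin n → Fin n → Fin n → ℝ) (Y Z : VF n)
    (x : Fin n → ℝ) (hC : ∀ k i j, DifferentiableAt ℝ (fun y => C y k i j) x)
    (hY : DifferentiableAt ℝ Y x) (hZ : ContDiffAt ℝ 2 Z x) :
    ricci (conn C) Y Z x = ∑ j, ∑ l, RicC C x j l * Y x j * Z x l := by
  have e : ∀ i, curv (conn C) (fun _ => Pi.single i 1) Y Z x i = 
      ∑ j, ∑ l, (pd i (fun y => C y i j l) x - pd j (fun y => C y i i l) x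
        + ∑ m, C x i i m * C x m j l - ∑ m, C x i j m * C x m i l) * Y x j * Z x l := by
    intro i
    rw [curv_conn C _ Y Z x hC (differentiableAt_const _) hY hZ]
    simp only [add_mul, sub_mul, Finset.sum_add_distrib, Finset.sum_sub_distrib]
    have t2 : ∑ a, ∑ j, fderiv ℝ (fun y => C y i a j) x (Y x) * 
        (Pi.single i (1:ℝ) : Fin n → ℝ) a * Z x j
        = ∑ j, ∑ l, pd j (fun y => C y i i l) x * Y x j * Z x l := by
      rw [Finset.sum_comm]
      conv_rhs => rw [Finset.sum_comm]
      refine Finset.sum_congr rfl fun l _ => ?_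
      simp only [Pi.single_apply, mul_ite, mul_one, mul_zero, ite_mul, zero_mul,
        Finset.sum_ite_eq', Finset.mem_univ, if_true]
      rw [fd_eq_pd, Finset.sum_mul]
      exact Finset.sum_congr rfl fun j _ => by ring
    have t3 : ∑ a, ∑ j, C x i a j * (Pi.single i (1:ℝ) : Fin n → ℝ) a * 
        ∑ p, ∑ q, C x j p q * Y x p * Z x q
        = ∑ j, ∑ l, (∑ m, C x i i m * C x m j l) * Y x j * Z x l := by
      simp only [Pi.single_apply, mul_ite, mul_one, mul_zero, ite_mul, zero_mul]
      rw [Finset.sum_comm]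
      simp only [Finset.sum_ite_eq', Finset.mem_univ, if_true, Finset.mul_sum, Finset.sum_mul]
      rw [Finset.sum_comm]
      refine Finset.sum_congr rfl fun p _ => ?_
      rw [Finset.sum_comm]
      refine Finset.sum_congr rfl fun q _ => Finset.sum_congr rfl fun m _ => by ring
    have t4 : ∑ a, ∑ j, C x i a j * Y x a * 
        ∑ p, ∑ q, C x j p q * (Pi.single i (1:ℝ) : Fin n → ℝ) p * Z x q
        = ∑ j, ∑ l, (∑ m, C x i j m * C x m i l) * Y x j * Z x l := by
      refine Finset.sum_congr rfl fun a _ => ?_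
      have : ∀ j, ∑ p, ∑ q, C x j p q * (Pi.single i (1:ℝ) : Fin n → ℝ) p * Z x q =
         ∑ q, C x j i q * Z x q := by
        intro j
        rw [Finset.sum_comm]
        refine Finset.sum_congr rfl fun q _ => ?_
        simp [Pi.single_apply]
      simp only [this, Finset.mul_sum, Finset.sum_mul]
      rw [Finset.sum_comm]
      refine Finset.sum_congr rfl fun q _ => Finset.sum_congr rfl fun m _ => by ring
    rw [t2, t3, t4]
    rfl
  rw [ricci, Finset.sum_congr rfl fun i _ => e i, Finset.sum_comm]
  refine Finset.sum_congr rfl fun j _ => ?_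
  rw [Finset.sum_comm]
  refine Finset.sum_congr rfl fun l _ => ?_
  rw [← Finset.sum_mul, ← Finset.sum_mul, RicC]
  simp only [Finset.sum_add_distrib, Finset.sum_sub_distrib]

lemma alg_diff {n : ℕ} (Γ : Fin n → Fin n → Fin n → ℝ) (G : Fin n → Fin n → ℝ)
    (p P : Fin n → ℝ) (dg : Fin n → Fin n → Fin n → ℝ) (dP dp : Fin n → Fin n → ℝ)
    (hΓ : ∀ k i j, Γ k i j = Γ k j i) (hG : ∀ i j, G i j = G j i)
    (hp : ∀ j, p j = ∑ m, G j m * P m) (j l : Fin n) :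
    (∑ i, ((if i = j then dp i l else 0) - (dg i j l * P i + G j l * dP i i)))
    - (∑ i, ((if i = i then dp j l else 0) - (dg j i l * P i + G i l * dP j i)))
    + (∑ i, ∑ m, (Γ i i m + (if i = i then p m else 0) - G i m * P i) *
        (Γ m j l + (if m = j then p l else 0) - G j l * P m))
    - (∑ i, ∑ m, (Γ i j m + (if i = j then p m else 0) - G j m * P i) *
        (Γ m i l + (if m = i then p l else 0) - G i l * P m))
    = ∑ i, ∑ m, Γ i i m * Γ m j l - ∑ i, ∑ m, Γ i j m * Γ m i l
     + (dp j l - n * dp j l + ∑ i, (dg j i l * P i + G i l * dP j i))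
     + ((n:ℝ) - 2) * ∑ m, p m * Γ m j l
     - G j l * (∑ i, dP i i + ∑ i, ∑ m, Γ i i m * P m)
     - ∑ i, dg i j l * P i
     + ∑ i, ∑ m, G i l * Γ i j m * P m + ∑ i, ∑ m, G j m * Γ m i l * P i
     + ((n:ℝ) - 2) * (p j * p l - G j l * ∑ m, p m * P m) := by
  have s1 : ∀ m, ∑ i, G i m * P i = p m := fun m => by
    rw [hp]; exact Finset.sum_congr rfl fun i _ => by rw [hG]
  have e1 : (∑ i, ((if i = j then dp i l else 0) - (dg i j l * P i + G j l * dP i i)))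
     = dp j l - ∑ i, dg i j l * P i - G j l * ∑ i, dP i i := by
    simp [Finset.sum_add_distrib, Finset.mul_sum, sub_sub]
  have e2 : (∑ i, ((if i = i then dp j l else 0) - (dg j i l * P i + G i l * dP j i)))
     = n * dp j l - ∑ i, (dg j i l * P i + G i l * dP j i) := by
    simp
  have e3 : (∑ i, ∑ m, (Γ i i m + (if i = i then p m else 0) - G i m * P i) *
        (Γ m j l + (if m = j then p l else 0) - G j l * P m))
      = ∑ m, (∑ i, Γ i i m + (n - 1) * p m) * 
        (Γ m j l + (if m = j then p l else 0) - G j l * P m) := by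
    rw [Finset.sum_comm]
    refine Finset.sum_congr rfl fun m _ => ?_
    rw [← Finset.sum_mul, Finset.sum_sub_distrib, Finset.sum_add_distrib, s1]
    simp; left; ring
  have e4 : ∑ m, (∑ i, Γ i i m + (n - 1) * p m) * 
        (Γ m j l + (if m = j then p l else 0) - G j l * P m) = 
        ∑ i, ∑ m, Γ i i m * Γ m j l + (n - 1) * ∑ m, p m * Γ m j l
        + (∑ i, Γ i i j + (n-1) * p j) * p l
        - G j l * (∑ i, ∑ m, Γ i i m * P m) - (n-1) * (G j l * ∑ m, p m * P m) := by
    have : ∀ m, (∑ i, Γ i i m + (n - 1) * p m) * 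
        (Γ m j l + (if m = j then p l else 0) - G j l * P m) =
        (∑ i, Γ i i m) * Γ m j l + (n-1) * (p m * Γ m j l) 
         + (if m = j then (∑ i, Γ i i m + (n - 1) * p m) * p l else 0)
         - G j l * ((∑ i, Γ i i m) * P m) - (n-1) * (G j l * (p m * P m)) := by
      intro m; split_ifs <;> ring
    simp only [this, Finset.sum_add_distrib, Finset.sum_sub_distrib, ← Finset.mul_sum]
    simp only [Finset.sum_ite_eq', Finset.mem_univ, if_true, Finset.sum_mul]
    rw [Finset.sum_comm, Finset.sum_comm (f := fun m i => Γ i i m * P m)]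
  have e5 : (∑ i, ∑ m, (Γ i j m + (if i = j then p m else 0) - G j m * P i) *
        (Γ m i l + (if m = i then p l else 0) - G i l * P m))
      = ∑ i, ∑ m, Γ i j m * Γ m i l + ∑ i, Γ i i j * p l - ∑ i, ∑ m, G i l * Γ i j m * P m
        + ∑ m, p m * Γ m j l + p j * p l - G j l * ∑ m, p m * P m
        - ∑ i, ∑ m, G j m * Γ m i l * P i - p j * p l + p j * p l := by
    have : ∀ i m, (Γ i j m + (if i = j then p m else 0) - G j m * P i) *
        (Γ m i l + (if m = i then p l else 0) - G i l * P m) =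
        Γ i j m * Γ m i l + (if m = i then Γ i m j * p l else 0) - G i l * Γ i j m * P m
        + (if i = j then p m * Γ m i l else 0) + (if m = i then if i = j then p m * p l else 0 else 0)
        - (if i = j then G i l * (p m * P m) else 0)
        - G j m * Γ m i l * P i - (if m = i then G j m * P i * p l else 0)
        + (G i l * P i) * (G j m * P m) := by
      intro i m; rw [hΓ i m j]; split_ifs <;> ring
    simp only [this, Finset.sum_add_distrib, Finset.sum_sub_distrib]
    have q1 : ∑ i, ∑ m, (if i = j then p m * Γ m i l else 0) = ∑ m, p m * Γ m j l := by
      rw [Finset.sum_comm]; simp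
    have q2 : ∑ i, ∑ m, (if i = j then G i l * (p m * P m) else 0) = G j l * ∑ m, p m * P m := by
      rw [Finset.sum_comm]; simp [Finset.mul_sum]
    have q3 : ∑ i, ∑ m, (G i l * P i) * (G j m * P m) = p j * p l := by
      rw [← Finset.sum_mul_sum, s1, ← hp]; ring
    rw [q1, q2, q3]
    simp only [Finset.sum_ite_eq', Finset.mem_univ, if_true, ← Finset.sum_mul, ← hp]
  rw [e1, e2, e3, e4, e5, ← Finset.sum_mul]
  ring

lemma pd_add {n : ℕ} {a b : (Fin n → ℝ) → ℝ} {x : Fin n → ℝ} (i : Fin n)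
    (ha : DifferentiableAt ℝ a x) (hb : DifferentiableAt ℝ b x) :
    pd i (fun y => a y + b y) x = pd i a x + pd i b x := by
  simp [pd, fderiv_fun_add ha hb]

lemma pd_sub {n : ℕ} {a b : (Fin n → ℝ) → ℝ} {x : Fin n → ℝ} (i : Fin n)
    (ha : DifferentiableAt ℝ a x) (hb : DifferentiableAt ℝ b x) :
    pd i (fun y => a y - b y) x = pd i a x - pd i b x := by
  simp [pd, fderiv_fun_sub ha hb]

lemma pd_mul {n : ℕ} {a b : (Fin n → ℝ) → ℝ} {x : Fin n → ℝ} (i : Fin n)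
    (ha : DifferentiableAt ℝ a x) (hb : DifferentiableAt ℝ b x) :
    pd i (fun y => a y * b y) x = pd i a x * b x + a x * pd i b x := by
  simp [pd, fderiv_fun_mul ha hb]; ring

lemma pd_sum {n : ℕ} {ι : Type*} [Fintype ι] {a : ι → (Fin n → ℝ) → ℝ} {x : Fin n → ℝ}
    (i : Fin n) (ha : ∀ k, DifferentiableAt ℝ (a k) x) :
    pd i (fun y => ∑ k, a k y) x = ∑ k, pd i (a k) x := fd_sum _ _ _ ha

lemma pd_congr {n : ℕ} {a b : (Fin n → ℝ) → ℝ} {x : Fin n → ℝ} (i : Fin n)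
    (h : a =ᶠ[nhds x] b) : pd i a x = pd i b x := by
  simp [pd, h.fderiv_eq]

lemma det_diff {n m : ℕ} (M : (Fin m → ℝ) → Matrix (Fin n) (Fin n) ℝ) (x : Fin m → ℝ)
    (h : ∀ i j, DifferentiableAt ℝ (fun y => M y i j) x) :
    DifferentiableAt ℝ (fun y => (M y).det) x := by
  simp only [Matrix.det_apply]
  refine DifferentiableAt.fun_sum fun σ _ => ?_
  refine DifferentiableAt.fun_const_smul ?_ _
  exact (HasFDerivAt.finsetProd (g := fun i y => M y (σ i) i)
    fun i _ => (h (σ i) i).hasFDerivAt).differentiableAt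

lemma inv_diff {n m : ℕ} (M : (Fin m → ℝ) → Matrix (Fin n) (Fin n) ℝ) (x : Fin m → ℝ)
    (h : ∀ i j, DifferentiableAt ℝ (fun y => M y i j) x) (h0 : (M x).det ≠ 0) (i j : Fin n) :
    DifferentiableAt ℝ (fun y => (M y)⁻¹ i j) x := by
  simp only [Matrix.inv_def, Ring.inverse_eq_inv', Matrix.smul_apply, smul_eq_mul]
  refine ((det_diff M x h).fun_inv h0).fun_mul ?_
  simp only [Matrix.adjugate_apply]
  refine det_diff _ x fun a b => ?_
  simp only [Matrix.updateRow_apply]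
  split_ifs
  · exact differentiableAt_const _
  · exact h _ _

/-- Facts at a point. -/
structure Good {n : ℕ} (g : (Fin n → ℝ) → Fin n → Fin n → ℝ) (x : Fin n → ℝ) : Prop where
  symm : ∀ᶠ y in nhds x, ∀ i j, g y i j = g y j i
  det : ∀ᶠ y in nhds x, (Matrix.of (g y)).det ≠ 0
  smooth : ∀ i j, ContDiffAt ℝ 2 (fun y => g y i j) x

namespace Good
variable {n : ℕ} {g : (Fin n → ℝ) → Fin n → Fin n → ℝ} {x : Fin n → ℝ}

lemma diff (h : Good g x) (i j) : DifferentiableAt ℝ (fun y => g y i j) x :=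
  (h.smooth i j).differentiableAt (by norm_num)

lemma pdiff (h : Good g x) (a i j) : DifferentiableAt ℝ (fun y => pd a (fun z => g z i j) y) x :=
  (dd (fun z => g z i j) (fun _ => Pi.single a 1) x 0 (h.smooth i j) (differentiableAt_const _)).1

lemma idiff (h : Good g x) (i j) : DifferentiableAt ℝ (fun y => (Matrix.of (g y))⁻¹ i j) x :=
  inv_diff (fun y => Matrix.of (g y)) x (fun i j => h.diff i j) h.det.self_of_nhds i j

lemma pdsymm (h : Good g x) (a i j) : pd a (fun y => g y i j) x = pd a (fun y => g y j i) x :=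
  pd_congr a (h.symm.mono fun _ hy => hy i j)

lemma pdpd (h : Good g x) (a b i j) : pd a (fun y => pd b (fun z => g z i j) y) x =
    pd b (fun y => pd a (fun z => g z i j) y) x := by
  have := (h.smooth i j).isSymmSndFDerivAt (by simp)
  have e : ∀ a b, pd a (fun y => pd b (fun z => g z i j) y) x =
      fderiv ℝ (fderiv ℝ (fun z => g z i j)) x (Pi.single a 1) (Pi.single b 1) := by
    intro a b
    have := (dd (fun z => g z i j) (fun _ => Pi.single b 1) x (Pi.single a 1) (h.smooth i j)
      (differentiableAt_const _)).2
    unfold pd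
    rw [this]
    have z : (fun k => fderiv ℝ (fun _ : Fin n → ℝ => (Pi.single b 1 : Fin n → ℝ) k) x
        (Pi.single a 1)) = (0 : Fin n → ℝ) := by
      funext k; simp
    rw [z, map_zero, add_zero]
  rw [e, e, this.eq]

lemma gammadiff (h : Good g x) (k i j) : DifferentiableAt ℝ (fun y => christoffel g y k i j) x := by
  unfold christoffel
  refine DifferentiableAt.const_mul ?_ _
  refine DifferentiableAt.fun_sum fun l _ => ?_
  exact (h.idiff k l).fun_mul (((h.pdiff _ _ _).fun_add (h.pdiff _ _ _)).fun_sub (h.pdiff _ _ _))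

lemma gammasymm (h : Good g x) (k i j) : christoffel g x k i j = christoffel g x k j i := by
  unfold christoffel
  congr 1
  refine Finset.sum_congr rfl fun l _ => ?_
  rw [h.pdsymm l i j]; ring

lemma isymm (h : Good g x) (i j) : (Matrix.of (g x))⁻¹ i j = (Matrix.of (g x))⁻¹ j i := by
  have : (Matrix.of (g x)).transpose = Matrix.of (g x) := by
    ext i j; exact h.symm.self_of_nhds j i
  conv_lhs => rw [← this, ← Matrix.transpose_nonsing_inv]
  rfl

lemma gi (h : Good g x) : Matrix.of (g x) * (Matrix.of (g x))⁻¹ = 1 :=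
  Matrix.mul_nonsing_inv _ (isUnit_iff_ne_zero.2 h.det.self_of_nhds)
lemma ig (h : Good g x) : (Matrix.of (g x))⁻¹ * Matrix.of (g x) = 1 :=
  Matrix.nonsing_inv_mul _ (isUnit_iff_ne_zero.2 h.det.self_of_nhds)

lemma lower (h : Good g x) (l i j) : ∑ k, g x l k * christoffel g x k i j =
    (1/2) * (pd i (fun y => g y j l) x + pd j (fun y => g y i l) x - pd l (fun y => g y i j) x) := by
  have e : ∀ m, ∑ k, g x l k * (Matrix.of (g x))⁻¹ k m = if l = m then 1 else 0 := by
    intro m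
    have := congrFun (congrFun h.gi l) m
    rw [Matrix.mul_apply, Matrix.one_apply] at this
    exact this
  unfold christoffel
  simp only [Finset.mul_sum]
  rw [Finset.sum_comm]
  have : ∀ m, ∑ k, g x l k * (1 / 2 * ((Matrix.of (g x))⁻¹ k m * 
      (pd i (fun y => g y j m) x + pd j (fun y => g y i m) x - pd m (fun y => g y i j) x)))
      = (∑ k, g x l k * (Matrix.of (g x))⁻¹ k m) * ((1/2) * 
        (pd i (fun y => g y j m) x + pd j (fun y => g y i m) x - pd m (fun y => g y i j) x)) := by
    intro m
    rw [Finset.sum_mul]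
    exact Finset.sum_congr rfl fun _ _ => by ring
  simp only [this, e]
  simp

/-- metric compatibility -/
lemma compat (h : Good g x) (i j l) : pd i (fun y => g y j l) x =
    ∑ k, g x l k * christoffel g x k i j + ∑ k, g x j k * christoffel g x k i l := by
  rw [h.lower, h.lower, h.pdsymm i l j, h.pdsymm j i l, h.pdsymm l i j, h.pdsymm j l i,
   h.pdsymm l j i]
  ring

lemma trgamma (h : Good g x) (m) : ∑ i, christoffel g x i i m =
    (1/2) * ∑ i, ∑ l, (Matrix.of (g x))⁻¹ i l * pd m (fun y => g y i l) x := by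
  unfold christoffel
  rw [← Finset.mul_sum]
  congr 1
  have e : ∑ i, ∑ l, (Matrix.of (g x))⁻¹ i l * pd i (fun y => g y m l) x
     = ∑ i, ∑ l, (Matrix.of (g x))⁻¹ i l * pd l (fun y => g y i m) x := by
    rw [Finset.sum_comm]
    refine Finset.sum_congr rfl fun i _ => Finset.sum_congr rfl fun l _ => ?_
    rw [h.isymm, h.pdsymm l m i]
  simp only [mul_add, mul_sub, Finset.sum_add_distrib, Finset.sum_sub_distrib, e]
  ring

end Good

lemma Good.ev {n : ℕ} {U : Set (Fin n → ℝ)} {g : (Fin n → ℝ) → Fin n → Fin n → ℝ}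
    (hU : IsOpen U) (hg : SmoothVF U g)
    (hgpos : ∀ x ∈ U, (Matrix.of (g x)).PosDef) (x) (hx : x ∈ U) : Good g x := by
  have hn : ∀ᶠ y in nhds x, y ∈ U := hU.mem_nhds hx
  refine ⟨hn.mono fun y hy i j => ?_, hn.mono fun y hy => (hgpos y hy).det_pos.ne', fun i j => ?_⟩
  · have := (hgpos y hy).1.apply i j
    simpa using this.symm
  · have h1 : ContDiffAt ℝ 2 g x := (ContDiffOn.contDiffAt hg (hU.mem_nhds hx)).of_le (WithTop.coe_le_coe.2 le_top)
    exact contDiffAt_pi.1 (contDiffAt_pi.1 h1 i) j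

lemma trgamma_symm {n : ℕ} {g : (Fin n → ℝ) → Fin n → Fin n → ℝ} {x : Fin n → ℝ}
    (h : ∀ᶠ y in nhds x, Good g y) (a b : Fin n) :
    ∑ i, pd a (fun y => christoffel g y i i b) x = ∑ i, pd b (fun y => christoffel g y i i a) x := by
  have h0 := h.self_of_nhds
  let D : Fin n → Matrix (Fin n) (Fin n) ℝ := fun a => Matrix.of fun i j => pd a (fun y => g y i j) x
  let E : Fin n → Matrix (Fin n) (Fin n) ℝ :=
    fun a => Matrix.of fun i j => pd a (fun y => (Matrix.of (g y))⁻¹ i j) x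
  set G := Matrix.of (g x) with hG
  have hE : ∀ a, E a * G + G⁻¹ * D a = 0 := by
    intro a
    ext i j
    have e : pd a (fun y => ∑ k, (Matrix.of (g y))⁻¹ i k * g y k j) x = 0 := by
      have : (fun y => ∑ k, (Matrix.of (g y))⁻¹ i k * g y k j) =ᶠ[nhds x]
          fun _ => (1 : Matrix (Fin n) (Fin n) ℝ) i j := by
        filter_upwards [h] with y hy
        rw [← hy.ig, Matrix.mul_apply]; rfl
      rw [pd_congr a this]; simp [pd]
    rw [pd_sum a (fun k => (h0.idiff i k).fun_mul (h0.diff k j))] at e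
    rw [Finset.sum_congr rfl fun k _ => pd_mul a (h0.idiff i k) (h0.diff k j),
      Finset.sum_add_distrib] at e
    exact e
  have hE' : ∀ a, E a = - (G⁻¹ * D a * G⁻¹) := by
    intro a
    have := congrArg (· * G⁻¹) (hE a)
    simp only [add_mul, zero_mul, Matrix.mul_assoc] at this
    rw [h0.gi, mul_one] at this
    rw [Matrix.mul_assoc]
    exact eq_neg_of_add_eq_zero_left this
  have key : ∀ a b, ∑ i, pd a (fun y => christoffel g y i i b) x =
     (1/2) * ((E a * D b).trace + 
      ∑ i, ∑ l, G⁻¹ i l * pd a (fun y => pd b (fun z => g z i l) y) x) := by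
    intro a b
    rw [← pd_sum a (fun i => h0.gammadiff i i b)]
    rw [pd_congr a (h.mono fun y hy => hy.trgamma b)]
    have p1 : ∀ i l, DifferentiableAt ℝ (fun y => (Matrix.of (g y))⁻¹ i l * 
      pd b (fun z => g z i l) y) x := fun i l => (h0.idiff i l).fun_mul (h0.pdiff b i l)
    have p2 : ∀ i, DifferentiableAt ℝ (fun y => ∑ l, (Matrix.of (g y))⁻¹ i l * 
      pd b (fun z => g z i l) y) x := fun i => DifferentiableAt.fun_sum fun l _ => p1 i l
    rw [pd_mul a (differentiableAt_const _) (DifferentiableAt.fun_sum fun i _ => p2 i),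
      pd_sum a p2]
    have : pd a (fun _ => (1/2 : ℝ)) x = 0 := by simp [pd]
    rw [this, zero_mul, zero_add]
    congr 1
    rw [Matrix.trace, ← Finset.sum_add_distrib]
    refine Finset.sum_congr rfl fun i _ => ?_
    rw [pd_sum a (p1 i), Matrix.diag_apply, Matrix.mul_apply, ← Finset.sum_add_distrib]
    refine Finset.sum_congr rfl fun l _ => ?_
    rw [pd_mul a (h0.idiff i l) (h0.pdiff b i l)]
    congr 1
    show E a i l * pd b (fun z => g z i l) x = E a i l * pd b (fun z => g z l i) x
    rw [h0.pdsymm]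
  rw [key, key]
  congr 2
  · rw [hE', hE']
    simp only [Matrix.neg_mul, Matrix.trace_neg]
    rw [Matrix.mul_assoc (G⁻¹ * D a), Matrix.trace_mul_comm, Matrix.mul_assoc (G⁻¹ * D b),
      ]
  · refine Finset.sum_congr rfl fun i _ => Finset.sum_congr rfl fun l _ => ?_
    rw [h0.pdpd]

lemma ric_symm {n : ℕ} {g : (Fin n → ℝ) → Fin n → Fin n → ℝ} {x : Fin n → ℝ}
    (h : ∀ᶠ y in nhds x, Good g y) (j l : Fin n) :
    RicC (christoffel g) x j l = RicC (christoffel g) x l j := by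
  have h0 := h.self_of_nhds
  unfold RicC
  rw [trgamma_symm h j l]
  have e1 : ∀ i, pd i (fun y => christoffel g y i j l) x = pd i (fun y => christoffel g y i l j) x :=
    fun i => pd_congr i (h.mono fun y hy => hy.gammasymm _ _ _)
  have e2 : ∑ i, ∑ m, christoffel g x i j m * christoffel g x m i l = 
     ∑ i, ∑ m, christoffel g x i l m * christoffel g x m i j := by
    rw [Finset.sum_comm]
    refine Finset.sum_congr rfl fun i _ => Finset.sum_congr rfl fun m _ => ?_
    rw [h0.gammasymm m j i, h0.gammasymm i m l]; ring
  have e3 : ∀ m, christoffel g x m j l = christoffel g x m l j := fun m => h0.gammasymm _ _ _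
  simp only [e1, e2, e3]

lemma ric_ss {n : ℕ} {g : (Fin n → ℝ) → Fin n → Fin n → ℝ} {x : Fin n → ℝ} (P : VF n)
    (h0 : Good g x) (hP : ∀ k, DifferentiableAt ℝ (fun y => P y k) x)
    (K : Fin n → Fin n → ℝ)
    (hK : ∀ i k, K i k = pd i (fun y => P y k) x + ∑ m, christoffel g x k i m * P x m)
    (j l : Fin n) :
    (∀ k a b, DifferentiableAt ℝ (fun y => ssC g P y k a b) x) ∧
    RicC (ssC g P) x j l = RicC (christoffel g) x j l
      - ((n:ℝ) - 2) * ∑ k, g x l k * K j k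
      - g x j l * ∑ i, K i i
      + ((n:ℝ) - 2) * ((∑ m, g x j m * P x m) * (∑ m, g x l m * P x m)
        - g x j l * ∑ m, (∑ a, g x m a * P x a) * P x m) := by
  have gsy := h0.symm.self_of_nhds
  have d1 : ∀ j m, DifferentiableAt ℝ (fun y => g y j m * P y m) x :=
    fun j m => (h0.diff j m).fun_mul (hP m)
  have d2 : ∀ j, DifferentiableAt ℝ (fun y => ∑ m, g y j m * P y m) x :=
    fun j => DifferentiableAt.fun_sum fun m _ => d1 j m
  have d3 : ∀ k i j : Fin n, DifferentiableAt ℝ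
      (fun y => if k = i then ∑ m, g y j m * P y m else 0) x := by
    intro k i j
    split_ifs
    · exact d2 j
    · exact differentiableAt_const _
  have d4 : ∀ i j k, DifferentiableAt ℝ (fun y => g y i j * P y k) x :=
    fun i j k => (h0.diff i j).fun_mul (hP k)
  refine ⟨fun k a b => ((h0.gammadiff k a b).fun_add (d3 k a b)).fun_sub (d4 a b k), ?_⟩
  have hpd : ∀ c k a b, pd c (fun y => ssC g P y k a b) x =
      pd c (fun y => christoffel g y k a b) x +
      ((if k = a then pd c (fun y => ∑ m, g y b m * P y m) x else 0) -
        (pd c (fun y => g y a b) x * P x k + g x a b * pd c (fun y => P y k) x)) := by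
    intro c k a b
    unfold ssC
    rw [pd_sub c ((h0.gammadiff k a b).fun_add (d3 k a b)) (d4 a b k),
      pd_add c (h0.gammadiff k a b) (d3 k a b), pd_mul c (h0.diff a b) (hP k), add_sub_assoc]
    congr 2
    split_ifs
    · rfl
    · simp [pd]
  have alg := alg_diff (christoffel g x) (g x) (fun j => ∑ m, g x j m * P x m) (P x)
    (fun c a b => pd c (fun y => g y a b) x) (fun c k => pd c (fun y => P y k) x)
    (fun c b => pd c (fun y => ∑ m, g y b m * P y m) x) h0.gammasymm gsy (fun _ => rfl) j l
  beta_reduce at alg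
  have hdp : pd j (fun y => ∑ m, g y l m * P y m) x =
      ∑ m, (pd j (fun y => g y m l) x * P x m + g x m l * pd j (fun y => P y m) x) := by
    rw [pd_sum j (d1 l)]
    refine Finset.sum_congr rfl fun m _ => ?_
    rw [pd_mul j (h0.diff l m) (hP m), h0.pdsymm, gsy l m]
  have hdp2 : pd j (fun y => ∑ m, g y l m * P y m) x =
      ∑ k, g x l k * K j k + ∑ m, (∑ a, g x m a * P x a) * christoffel g x m j l := by
    rw [hdp]
    have a1 : ∑ k, g x l k * K j k = ∑ k, g x k l * pd j (fun y => P y k) x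
       + ∑ m, (∑ k, g x l k * christoffel g x k j m) * P x m := by
      simp only [hK, mul_add, Finset.sum_add_distrib, Finset.mul_sum, Finset.sum_mul]
      congr 1
      · exact Finset.sum_congr rfl fun k _ => by rw [gsy]
      · rw [Finset.sum_comm]
        exact Finset.sum_congr rfl fun k _ => Finset.sum_congr rfl fun k _ => by ring
    have a2 : ∑ m, (∑ a, g x m a * P x a) * christoffel g x m j l =
        ∑ m, (∑ k, g x m k * christoffel g x k j l) * P x m := by
      simp only [Finset.sum_mul]
      rw [Finset.sum_comm]
      exact Finset.sum_congr rfl fun k _ => Finset.sum_congr rfl fun i _ => by rw [gsy i k]; ring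
    rw [a1, a2, add_assoc, ← Finset.sum_add_distrib, Finset.sum_add_distrib, add_comm]
    congr 1
    refine Finset.sum_congr rfl fun m _ => ?_
    rw [h0.compat j m l]; ring
  have hcomp : ∑ i, pd i (fun y => g y j l) x * P x i =
      ∑ i, ∑ m, g x i l * christoffel g x i j m * P x m
      + ∑ i, ∑ m, g x j m * christoffel g x m i l * P x i := by
    rw [Finset.sum_comm (f := fun i m => g x i l * christoffel g x i j m * P x m),
      ← Finset.sum_add_distrib]
    refine Finset.sum_congr rfl fun i _ => ?_
    rw [h0.compat i j l, add_mul, Finset.sum_mul, Finset.sum_mul]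
    congr 1
    exact Finset.sum_congr rfl fun m _ => by rw [gsy l m, h0.gammasymm m i j]
  have hdiv : ∑ i, K i i = ∑ i, pd i (fun y => P y i) x +
      ∑ i, ∑ m, christoffel g x i i m * P x m := by
    simp only [hK, Finset.sum_add_distrib]
  have expand : RicC (ssC g P) x j l - RicC (christoffel g) x j l =
     _ - (∑ i, ∑ m, christoffel g x i i m * christoffel g x m j l
       - ∑ i, ∑ m, christoffel g x i j m * christoffel g x m i l) :=
    (by
      unfold RicC
      simp only [hpd]
      rw [Finset.sum_add_distrib, Finset.sum_add_distrib]
      simp only [ssC]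
      ring : _ = ((∑ i, ((if i = j then pd i (fun y => ∑ m, g y l m * P y m) x else 0) -
          (pd i (fun y => g y j l) x * P x i + g x j l * pd i (fun y => P y i) x)))
       - (∑ i, ((if i = i then pd j (fun y => ∑ m, g y l m * P y m) x else 0) -
          (pd j (fun y => g y i l) x * P x i + g x i l * pd j (fun y => P y i) x)))
       + (∑ i, ∑ m, (christoffel g x i i m + (if i = i then ∑ a, g x m a * P x a else 0)
          - g x i m * P x i) * (christoffel g x m j l +
          (if m = j then ∑ a, g x l a * P x a else 0) - g x j l * P x m))
       - (∑ i, ∑ m, (christoffel g x i j m + (if i = j then ∑ a, g x m a * P x a else 0)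
          - g x j m * P x i) * (christoffel g x m i l +
          (if m = i then ∑ a, g x l a * P x a else 0) - g x i l * P x m))) -
       (∑ i, ∑ m, christoffel g x i i m * christoffel g x m j l
       - ∑ i, ∑ m, christoffel g x i j m * christoffel g x m i l))
  rw [alg, ← hdp, ← hdiv, hcomp, hdp2] at expand
  linarith

/-- On an open `U ⊆ ℝⁿ` (`n ≥ 3`) with Riemannian metric `g`, Levi-Civita
connection `∇`, vector field `P`, `π(X) = g(X,P)`, semi-symmetric metric connection `∇̄`,
`S = Ric_∇`, `S̄ = Ric_∇̄`, `Ŝ = sym S̄`: if `P` is a Killing vector field of `g`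
(`g(∇_X P, Y) + g(∇_Y P, X) = 0` for all vector fields `X, Y`), then for all vector fields
`Y, Z`: `Ŝ(Y,Z) = S(Y,Z) + (n−2)π(Y)π(Z) − (n−2)g(P,P)g(Y,Z)`. -/
theorem statement5 (n : ℕ) (hn : 3 ≤ n)
    (U : Set (Fin n → ℝ)) (hU : IsOpen U)
    (g : (Fin n → ℝ) → Fin n → Fin n → ℝ) (hg : SmoothVF U g)
    (hgpos : ∀ x ∈ U, (Matrix.of (g x)).PosDef)
    (P : VF n) (hP : SmoothVF U P)
    (hKilling : ∀ X Y : VF n, SmoothVF U X → SmoothVF U Y → ∀ x ∈ U,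
      gval g x (lcCov g X P x) (Y x) + gval g x (lcCov g Y P x) (X x) = 0) :
    ∀ Y Z : VF n, SmoothVF U Y → SmoothVF U Z → ∀ x ∈ U,
      shat g P Y Z x =
        ricci (lcCov g) Y Z x
          + ((n : ℝ) - 2) * (gval g x (Y x) (P x) * gval g x (Z x) (P x))
          - ((n : ℝ) - 2) * gval g x (P x) (P x) * gval g x (Y x) (Z x) := by
  intro Y Z hY hZ x hx
  have hn : ∀ᶠ y in nhds x, y ∈ U := hU.mem_nhds hx
  have hgood : ∀ᶠ y in nhds x, Good g y := hn.mono fun y hy => Good.ev hU hg hgpos y hy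
  have h0 := hgood.self_of_nhds
  have gsy := h0.symm.self_of_nhds
  have c2 : ∀ W : VF n, SmoothVF U W → ContDiffAt ℝ 2 W x := fun W hW =>
    (ContDiffOn.contDiffAt hW (hU.mem_nhds hx)).of_le (WithTop.coe_le_coe.2 le_top)
  have c1 : ∀ W : VF n, SmoothVF U W → DifferentiableAt ℝ W x := fun W hW =>
    (c2 W hW).differentiableAt (by norm_num)
  have hPd := differentiableAt_pi.1 (c1 P hP)
  let K : Fin n → Fin n → ℝ := fun i k =>
    pd i (fun y => P y k) x + ∑ m, christoffel g x k i m * P x m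
  have hss := fun j l => ric_ss P h0 hPd K (fun _ _ => rfl) j l
  -- Killing in components
  have kl : ∀ j l, ∑ k, g x l k * K j k + ∑ k, g x j k * K l k = 0 := by
    intro j l
    have hk := hKilling (fun _ => Pi.single j 1) (fun _ => Pi.single l 1) contDiffOn_const
      contDiffOn_const x hx
    have e : ∀ j l, gval g x (lcCov g (fun _ => Pi.single j 1) P x) (Pi.single l 1) =
        ∑ k, g x l k * K j k := by
      intro j l
      unfold gval
      refine Finset.sum_congr rfl fun k _ => ?_
      have : lcCov g (fun _ => Pi.single j 1) P x k = K j k := by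
        simp only [lcCov, K, pd]
        congr 1
        rw [Finset.sum_comm]
        refine Finset.sum_congr rfl fun m _ => ?_
        simp [Pi.single_apply]
      rw [this, gsy l k]
      simp [Pi.single_apply]
    rw [e, e] at hk
    exact hk
  have hdiv : ∑ i, K i i = 0 := by
    have e : ∑ i, K i i = ∑ j, ∑ l, (Matrix.of (g x))⁻¹ j l * ∑ k, g x l k * K j k := by
      refine Finset.sum_congr rfl fun j _ => ?_
      simp only [Finset.mul_sum]
      rw [Finset.sum_comm]
      have : ∀ k, ∑ l, (Matrix.of (g x))⁻¹ j l * (g x l k * K j k) =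
          (if j = k then 1 else 0) * K j k := by
        intro k
        have := congrFun (congrFun h0.ig j) k
        rw [Matrix.mul_apply, Matrix.one_apply] at this
        rw [← this, Finset.sum_mul]
        exact Finset.sum_congr rfl fun l _ => by rw [Matrix.of_apply]; ring
      simp [this]
    have e' : ∑ i, K i i = ∑ j, ∑ l, (Matrix.of (g x))⁻¹ j l * ∑ k, g x j k * K l k := by
      rw [e, Finset.sum_comm]
      refine Finset.sum_congr rfl fun j _ => Finset.sum_congr rfl fun l _ => ?_
      rw [h0.isymm]
    have : ∑ i, K i i + ∑ i, K i i = 0 := by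
      refine (congrArg₂ (· + ·) e e').trans ?_
      beta_reduce
      rw [← Finset.sum_add_distrib]
      refine Finset.sum_eq_zero fun j _ => ?_
      rw [← Finset.sum_add_distrib]
      refine Finset.sum_eq_zero fun l _ => ?_
      rw [← mul_add, kl, mul_zero]
    linarith
  have hC := fun k a b => (hss k k).1 k a b
  rw [shat, ssCov_eq, lcCov_eq, ricci_conn _ Y Z x hC (c1 Y hY) (c2 Z hZ),
    ricci_conn _ Z Y x hC (c1 Z hZ) (c2 Y hY),
    ricci_conn _ Y Z x h0.gammadiff (c1 Y hY) (c2 Z hZ)]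
  rw [Finset.sum_comm (f := fun j l => RicC (ssC g P) x j l * Z x j * Y x l),
    ← Finset.sum_add_distrib]
  have gP : ∀ v : Fin n → ℝ, gval g x v (P x) = ∑ j, (∑ m, g x j m * P x m) * v j := by
    intro v
    unfold gval
    simp only [Finset.sum_mul]
    exact Finset.sum_congr rfl fun _ _ => Finset.sum_congr rfl fun _ _ => by ring
  have main : ∀ j l, RicC (ssC g P) x j l + RicC (ssC g P) x l j =
      2 * (RicC (christoffel g) x j l +
       ((n:ℝ) - 2) * ((∑ m, g x j m * P x m) * (∑ m, g x l m * P x m))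
        - ((n:ℝ) - 2) * gval g x (P x) (P x) * g x j l) := by
    intro j l
    rw [(hss j l).2, (hss l j).2, hdiv, gP, ric_symm hgood l j, gsy l j]
    linear_combination (-((n:ℝ) - 2)) * kl j l
  rw [gP (Y x), gP (Z x), Finset.sum_mul_sum, Finset.mul_sum, 
    show gval g x (Y x) (Z x) = ∑ i, ∑ j, g x i j * Y x i * Z x j from rfl,
    Finset.mul_sum, ← Finset.sum_add_distrib, ← Finset.sum_sub_distrib, Finset.sum_div]
  refine Finset.sum_congr rfl fun j _ => ?_
  rw [← Finset.sum_add_distrib, Finset.mul_sum, Finset.mul_sum, ← Finset.sum_add_distrib,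
    ← Finset.sum_sub_distrib, Finset.sum_div]
  refine Finset.sum_congr rfl fun l _ => ?_
  linear_combination (Y x j * Z x l / 2) * main j l
end

section
/- Suppose g(P,P) = 1 everywhere, S(Y,Z) = (n−2)g(Y,Z) − (n−2)π(Y)π(Z) for all vector fields Y, Z, and ∇S ≡ 0. Then ∇̄Ŝ ≡ 0, i.e. (∇̄_X Ŝ)(Y,Z) = 0 for all vector fields X, Y, Z. -/
open scoped BigOperators

section helpers

variable {n : ℕ} {U : Set (Fin n → ℝ)} {g : (Fin n → ℝ) → Fin n → Fin n → ℝ}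

lemma gval_add_left (x u v w : Fin n → ℝ) : gval g x (u + v) w = gval g x u w + gval g x v w := by
  simp only [gval, ← Finset.sum_add_distrib, Pi.add_apply]
  refine Finset.sum_congr rfl fun i _ => Finset.sum_congr rfl fun j _ => by ring

lemma gval_smul_left (x : Fin n → ℝ) (c : ℝ) (u w : Fin n → ℝ) :
    gval g x (c • u) w = c * gval g x u w := by
  simp only [gval, Finset.mul_sum, Pi.smul_apply, smul_eq_mul]
  refine Finset.sum_congr rfl fun i _ => Finset.sum_congr rfl fun j _ => by ring

lemma g_symm (hgpos : ∀ x ∈ U, (Matrix.of (g x)).PosDef) {x : Fin n → ℝ} (hx : x ∈ U)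
    (i j : Fin n) : g x i j = g x j i := by
  have := (hgpos x hx).1.apply i j
  simpa using this.symm

lemma gval_comm (hgpos : ∀ x ∈ U, (Matrix.of (g x)).PosDef) {x : Fin n → ℝ} (hx : x ∈ U)
    (v w : Fin n → ℝ) : gval g x v w = gval g x w v := by
  unfold gval
  rw [Finset.sum_comm]
  refine Finset.sum_congr rfl fun i _ => Finset.sum_congr rfl fun j _ => ?_
  rw [g_symm hgpos hx]; ring

lemma gval_self_eq_zero (hgpos : ∀ x ∈ U, (Matrix.of (g x)).PosDef) {x : Fin n → ℝ}
    (hx : x ∈ U) (v : Fin n → ℝ) (h : gval g x v v = 0) : v = 0 := by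
  by_contra hv
  have := (hgpos x hx).dotProduct_mulVec_pos hv
  have e : star v ⬝ᵥ (Matrix.of (g x)).mulVec v = gval g x v v := by
    simp only [dotProduct, Matrix.mulVec, gval, Finset.mul_sum, Matrix.of_apply, Pi.star_apply,
      star_trivial]
    refine Finset.sum_congr rfl fun i _ => Finset.sum_congr rfl fun j _ => by ring
  rw [e, h] at this
  exact lt_irrefl _ this

lemma smooth_g (hg : SmoothVF U g) (i j : Fin n) :
    ContDiffOn ℝ (⊤ : ℕ∞) (fun y => g y i j) U :=
  contDiffOn_pi.1 (contDiffOn_pi.1 hg i) j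

lemma smooth_comp {Y : VF n} (hY : SmoothVF U Y) (i : Fin n) :
    ContDiffOn ℝ (⊤ : ℕ∞) (fun y => Y y i) U :=
  contDiffOn_pi.1 hY i

lemma smooth_dir (hU : IsOpen U) {f : (Fin n → ℝ) → ℝ} (hf : ContDiffOn ℝ (⊤ : ℕ∞) f U)
    {X : VF n} (hX : SmoothVF U X) :
    ContDiffOn ℝ (⊤ : ℕ∞) (fun y => fderiv ℝ f y (X y)) U :=
  (hf.fderiv_of_isOpen (m := (⊤ : ℕ∞)) hU (by simp)).clm_apply hX

lemma smooth_pd (hU : IsOpen U) {f : (Fin n → ℝ) → ℝ} (hf : ContDiffOn ℝ (⊤ : ℕ∞) f U)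
    (i : Fin n) : ContDiffOn ℝ (⊤ : ℕ∞) (pd i f) U :=
  smooth_dir hU hf (X := fun _ => Pi.single i 1) contDiffOn_const

lemma smooth_det {A : (Fin n → ℝ) → Matrix (Fin n) (Fin n) ℝ}
    (hA : ∀ i j, ContDiffOn ℝ (⊤ : ℕ∞) (fun y => A y i j) U) :
    ContDiffOn ℝ (⊤ : ℕ∞) (fun y => (A y).det) U := by
  simp only [Matrix.det_apply']
  exact ContDiffOn.sum fun s _ => contDiffOn_const.mul (contDiffOn_prod fun i _ => hA _ _)

lemma smooth_inv (hg : SmoothVF U g) (hgpos : ∀ x ∈ U, (Matrix.of (g x)).PosDef) (k l : Fin n) :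
    ContDiffOn ℝ (⊤ : ℕ∞) (fun y => (Matrix.of (g y))⁻¹ k l) U := by
  simp only [Matrix.inv_def, Matrix.smul_apply, Ring.inverse_eq_inv', smul_eq_mul,
    Matrix.adjugate_apply]
  refine ContDiffOn.mul (ContDiffOn.inv (smooth_det fun i j => ?_) fun x hx => ?_)
    (smooth_det fun i j => ?_)
  · exact smooth_g hg i j
  · exact (hgpos x hx).det_pos.ne'
  · by_cases h : i = l
    · subst h; simpa using contDiffOn_const
    · simpa [Matrix.updateRow_apply, h] using smooth_g hg i j

lemma smooth_christoffel (hU : IsOpen U) (hg : SmoothVF U g)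
    (hgpos : ∀ x ∈ U, (Matrix.of (g x)).PosDef) (k i j : Fin n) :
    ContDiffOn ℝ (⊤ : ℕ∞) (fun y => christoffel g y k i j) U := by
  unfold christoffel
  refine contDiffOn_const.mul (ContDiffOn.sum fun l _ => (smooth_inv hg hgpos k l).mul ?_)
  exact ((smooth_pd hU (smooth_g hg j l) i).add (smooth_pd hU (smooth_g hg i l) j)).sub
    (smooth_pd hU (smooth_g hg i j) l)

lemma smooth_lcCov (hU : IsOpen U) (hg : SmoothVF U g)
    (hgpos : ∀ x ∈ U, (Matrix.of (g x)).PosDef) {X Y : VF n} (hX : SmoothVF U X)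
    (hY : SmoothVF U Y) : SmoothVF U (lcCov g X Y) := by
  refine contDiffOn_pi.2 fun k => ?_
  unfold lcCov
  exact (smooth_dir hU (smooth_comp hY k) hX).add (ContDiffOn.sum fun i _ => ContDiffOn.sum fun j _ =>
    ((smooth_christoffel hU hg hgpos k i j).mul (smooth_comp hX i)).mul (smooth_comp hY j))

lemma smooth_gval (hg : SmoothVF U g) {X Y : VF n} (hX : SmoothVF U X)
    (hY : SmoothVF U Y) : ContDiffOn ℝ (⊤ : ℕ∞) (fun y => gval g y (X y) (Y y)) U := by
  unfold gval
  exact ContDiffOn.sum fun i _ => ContDiffOn.sum fun j _ =>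
    ((smooth_g hg i j).mul (smooth_comp hX i)).mul (smooth_comp hY j)

lemma smooth_ssCov (hU : IsOpen U) (hg : SmoothVF U g)
    (hgpos : ∀ x ∈ U, (Matrix.of (g x)).PosDef) {P X Y : VF n} (hP : SmoothVF U P)
    (hX : SmoothVF U X) (hY : SmoothVF U Y) : SmoothVF U (ssCov g P X Y) := by
  refine contDiffOn_pi.2 fun k => ?_
  unfold ssCov
  exact ((smooth_comp (smooth_lcCov hU hg hgpos hX hY) k).add
    ((smooth_gval hg hY hP).mul (smooth_comp hX k))).sub
    ((smooth_gval hg hX hY).mul (smooth_comp hP k))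

lemma diffAt (hU : IsOpen U) {f : (Fin n → ℝ) → ℝ} (hf : ContDiffOn ℝ (⊤ : ℕ∞) f U)
    {x : Fin n → ℝ} (hx : x ∈ U) : DifferentiableAt ℝ f x :=
  (hf.contDiffAt (hU.mem_nhds hx)).differentiableAt (by simp)

lemma pd_symm (hU : IsOpen U) (hgpos : ∀ x ∈ U, (Matrix.of (g x)).PosDef) {x : Fin n → ℝ}
    (hx : x ∈ U) (k i j : Fin n) : pd k (fun y => g y i j) x = pd k (fun y => g y j i) x := by
  unfold pd
  have : (fun y => g y i j) =ᶠ[nhds x] (fun y => g y j i) := by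
    filter_upwards [hU.mem_nhds hx] with y hy using g_symm hgpos hy i j
  rw [this.fderiv_eq]

lemma christoffel_symm (hU : IsOpen U) (hgpos : ∀ x ∈ U, (Matrix.of (g x)).PosDef)
    {x : Fin n → ℝ} (hx : x ∈ U) (k i j : Fin n) :
    christoffel g x k i j = christoffel g x k j i := by
  unfold christoffel
  congr 1
  refine Finset.sum_congr rfl fun l _ => ?_
  rw [pd_symm hU hgpos hx l i j]; ring

lemma christoffel_lower (hgpos : ∀ x ∈ U, (Matrix.of (g x)).PosDef)
    {x : Fin n → ℝ} (hx : x ∈ U) (m i j : Fin n) :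
    ∑ k, g x m k * christoffel g x k i j =
      (1 / 2) * (pd i (fun y => g y j m) x + pd j (fun y => g y i m) x
        - pd m (fun y => g y i j) x) := by
  have hinv : Matrix.of (g x) * (Matrix.of (g x))⁻¹ = 1 :=
    Matrix.mul_nonsing_inv _ (hgpos x hx).det_pos.ne'.isUnit
  unfold christoffel
  set c : Fin n → ℝ := fun l => pd i (fun y => g y j l) x + pd j (fun y => g y i l) x
        - pd l (fun y => g y i j) x with hc
  have : ∑ l, (∑ k, g x m k * (Matrix.of (g x))⁻¹ k l) * c l = c m := by
    have h2 : ∀ l, ∑ k, g x m k * (Matrix.of (g x))⁻¹ k l = (1 : Matrix (Fin n) (Fin n) ℝ) m l := by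
      intro l; rw [← hinv, Matrix.mul_apply]; rfl
    simp [h2, Matrix.one_apply]
  change ∑ k, g x m k * ((1/2) * ∑ l, (Matrix.of (g x))⁻¹ k l * c l) = (1/2) * c m
  rw [← this]
  simp only [Finset.mul_sum, Finset.sum_mul]
  rw [Finset.sum_comm]
  refine Finset.sum_congr rfl fun i _ => Finset.sum_congr rfl fun j _ => by ring

lemma compat_coord (hU : IsOpen U) (hgpos : ∀ x ∈ U, (Matrix.of (g x)).PosDef)
    {x : Fin n → ℝ} (hx : x ∈ U) (k i j : Fin n) :
    pd k (fun y => g y i j) x =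
      ∑ m, g x m j * christoffel g x m k i + ∑ m, g x i m * christoffel g x m k j := by
  have h1 := christoffel_lower hgpos hx j k i
  have h2 := christoffel_lower hgpos hx i k j
  simp only [g_symm hgpos hx j] at h1
  rw [h1, h2, pd_symm hU hgpos hx i k j, pd_symm hU hgpos hx k j i, pd_symm hU hgpos hx j k i,
    pd_symm hU hgpos hx i j k]
  ring

lemma fderiv_eq_sum_pd (f : (Fin n → ℝ) → ℝ) (x v : Fin n → ℝ) :
    fderiv ℝ f x v = ∑ k, v k * pd k f x := by
  conv_lhs => rw [pi_eq_sum_univ' v]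
  simp only [map_sum, map_smul, smul_eq_mul, pd]

lemma compat (hU : IsOpen U) (hg : SmoothVF U g) (hgpos : ∀ x ∈ U, (Matrix.of (g x)).PosDef)
    {X Y Z : VF n} (hY : SmoothVF U Y) (hZ : SmoothVF U Z) {x : Fin n → ℝ} (hx : x ∈ U) :
    fderiv ℝ (fun y => gval g y (Y y) (Z y)) x (X x) =
      gval g x (lcCov g X Y x) (Z x) + gval g x (Y x) (lcCov g X Z x) := by
  have dg := fun i j => diffAt hU (smooth_g hg i j) hx
  have dY := fun i => diffAt hU (smooth_comp hY i) hx
  have dZ := fun i => diffAt hU (smooth_comp hZ i) hx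
  have e : fderiv ℝ (fun y => gval g y (Y y) (Z y)) x (X x) =
      ∑ i, ∑ j, (fderiv ℝ (fun y => g y i j) x (X x) * Y x i * Z x j
        + g x i j * fderiv ℝ (fun y => Y y i) x (X x) * Z x j
        + g x i j * Y x i * fderiv ℝ (fun y => Z y j) x (X x)) := by
    have : HasFDerivAt (fun y => gval g y (Y y) (Z y)) _ x :=
      HasFDerivAt.fun_sum fun i (_ : i ∈ Finset.univ) =>
        HasFDerivAt.fun_sum fun j (_ : j ∈ Finset.univ) =>
        ((dg i j).hasFDerivAt.mul (dY i).hasFDerivAt).mul (dZ j).hasFDerivAt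
    rw [this.fderiv]
    simp only [_root_.sum_apply, _root_.add_apply,
      _root_.smul_apply, smul_eq_mul, Pi.mul_apply]
    refine Finset.sum_congr rfl fun i _ => Finset.sum_congr rfl fun j _ => by ring
  rw [e]
  have e1 : ∑ i, ∑ j, fderiv ℝ (fun y => g y i j) x (X x) * Y x i * Z x j =
      ∑ i, ∑ j, g x i j * (∑ a, ∑ b, christoffel g x i a b * X x a * Y x b) * Z x j
      + ∑ i, ∑ j, g x i j * Y x i * (∑ a, ∑ b, christoffel g x j a b * X x a * Z x b) := by
    have p1 : ∑ i, ∑ j, g x i j * (∑ a, ∑ b, christoffel g x i a b * X x a * Y x b) * Z x j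
        = ∑ i, ∑ j, (∑ k, X x k * ∑ m, g x m j * christoffel g x m k i) * Y x i * Z x j := by
      simp only [Finset.mul_sum, Finset.sum_mul]
      calc _ = ∑ i, ∑ j, ∑ b, ∑ a, g x i j * (christoffel g x i a b * X x a * Y x b) * Z x j :=
            Finset.sum_congr rfl fun i _ => Finset.sum_congr rfl fun j _ => Finset.sum_comm
        _ = ∑ i, ∑ b, ∑ j, ∑ a, g x i j * (christoffel g x i a b * X x a * Y x b) * Z x j :=
            Finset.sum_congr rfl fun i _ => Finset.sum_comm
        _ = ∑ b, ∑ i, ∑ j, ∑ a, g x i j * (christoffel g x i a b * X x a * Y x b) * Z x j :=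
            Finset.sum_comm
        _ = ∑ b, ∑ j, ∑ i, ∑ a, g x i j * (christoffel g x i a b * X x a * Y x b) * Z x j :=
            Finset.sum_congr rfl fun i _ => Finset.sum_comm
        _ = ∑ b, ∑ j, ∑ a, ∑ i, g x i j * (christoffel g x i a b * X x a * Y x b) * Z x j :=
            Finset.sum_congr rfl fun i _ => Finset.sum_congr rfl fun j _ => Finset.sum_comm
        _ = _ := Finset.sum_congr rfl fun i _ => Finset.sum_congr rfl fun j _ =>
            Finset.sum_congr rfl fun k _ => Finset.sum_congr rfl fun m _ => by ring
    have p2 : ∑ i, ∑ j, g x i j * Y x i * (∑ a, ∑ b, christoffel g x j a b * X x a * Z x b)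
        = ∑ i, ∑ j, (∑ k, X x k * ∑ m, g x i m * christoffel g x m k j) * Y x i * Z x j := by
      simp only [Finset.mul_sum, Finset.sum_mul]
      refine Finset.sum_congr rfl fun i _ => ?_
      calc _ = ∑ j, ∑ b, ∑ a, g x i j * Y x i * (christoffel g x j a b * X x a * Z x b) :=
            Finset.sum_congr rfl fun j _ => Finset.sum_comm
        _ = ∑ b, ∑ j, ∑ a, g x i j * Y x i * (christoffel g x j a b * X x a * Z x b) :=
            Finset.sum_comm
        _ = ∑ b, ∑ a, ∑ j, g x i j * Y x i * (christoffel g x j a b * X x a * Z x b) :=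
            Finset.sum_congr rfl fun j _ => Finset.sum_comm
        _ = _ := Finset.sum_congr rfl fun j _ =>
            Finset.sum_congr rfl fun k _ => Finset.sum_congr rfl fun m _ => by ring
    rw [p1, p2]
    simp only [← Finset.sum_add_distrib]
    refine Finset.sum_congr rfl fun i _ => Finset.sum_congr rfl fun j _ => ?_
    rw [fderiv_eq_sum_pd]
    simp only [compat_coord hU hgpos hx, mul_add, Finset.sum_add_distrib, add_mul]
  simp only [Finset.sum_add_distrib]
  rw [e1]
  simp only [gval, lcCov, mul_add, add_mul, Finset.sum_add_distrib]
  ring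

lemma lie_eq (hU : IsOpen U) (hgpos : ∀ x ∈ U, (Matrix.of (g x)).PosDef)
    (X Y : VF n) {x : Fin n → ℝ} (hx : x ∈ U) :
    lie X Y x = lcCov g X Y x - lcCov g Y X x := by
  ext k
  simp only [lie, lcCov, Pi.sub_apply]
  have : ∑ i, ∑ j, christoffel g x k i j * Y x i * X x j
      = ∑ i, ∑ j, christoffel g x k i j * X x i * Y x j := by
    rw [Finset.sum_comm]
    refine Finset.sum_congr rfl fun i _ => Finset.sum_congr rfl fun j _ => ?_
    rw [christoffel_symm hU hgpos hx]; ring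
  rw [this]; ring

lemma lcCov_comb (hU : IsOpen U) (X : VF n) {A B C : VF n} {f h : (Fin n → ℝ) → ℝ}
    (hA : SmoothVF U A) (hB : SmoothVF U B) (hC : SmoothVF U C)
    (hf : ContDiffOn ℝ (⊤ : ℕ∞) f U) (hh : ContDiffOn ℝ (⊤ : ℕ∞) h U)
    {x : Fin n → ℝ} (hx : x ∈ U) (k : Fin n) :
    lcCov g X (fun y k => A y k + f y * B y k - h y * C y k) x k =
      lcCov g X A x k + (fderiv ℝ f x (X x) * B x k + f x * lcCov g X B x k)
        - (fderiv ℝ h x (X x) * C x k + h x * lcCov g X C x k) := by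
  have dA := (diffAt hU (smooth_comp hA k) hx).hasFDerivAt
  have dB := (diffAt hU (smooth_comp hB k) hx).hasFDerivAt
  have dC := (diffAt hU (smooth_comp hC k) hx).hasFDerivAt
  have df := (diffAt hU hf hx).hasFDerivAt
  have dh := (diffAt hU hh hx).hasFDerivAt
  have : HasFDerivAt (fun y => A y k + f y * B y k - h y * C y k) _ x :=
    (dA.add (df.mul dB)).sub (dh.mul dC)
  simp only [lcCov]
  rw [this.fderiv]
  simp only [_root_.sub_apply, _root_.add_apply,
      _root_.smul_apply, smul_eq_mul]
  have e : ∑ i, ∑ j, christoffel g x k i j * X x i * (A x j + f x * B x j - h x * C x j)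
      = ∑ i, ∑ j, christoffel g x k i j * X x i * A x j
       + f x * ∑ i, ∑ j, christoffel g x k i j * X x i * B x j
       - h x * ∑ i, ∑ j, christoffel g x k i j * X x i * C x j := by
    simp only [Finset.mul_sum, ← Finset.sum_add_distrib, ← Finset.sum_sub_distrib]
    refine Finset.sum_congr rfl fun i _ => Finset.sum_congr rfl fun j _ => by ring
  rw [e]; ring

/-- Second covariant derivative with respect to the semi-symmetric connection, for parallel `P`. -/
lemma ss_ss (hU : IsOpen U) (hg : SmoothVF U g) (hgpos : ∀ x ∈ U, (Matrix.of (g x)).PosDef)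
    {P : VF n} (hP : SmoothVF U P) {x : Fin n → ℝ} (hx : x ∈ U)
    (hPunit : gval g x (P x) (P x) = 1)
    {X Y Z : VF n} (hpar : lcCov g X P x = 0)
    (hY : SmoothVF U Y) (hZ : SmoothVF U Z) (k : Fin n) :
    ssCov g P X (ssCov g P Y Z) x k =
      lcCov g X (lcCov g Y Z) x k
      + gval g x (lcCov g X Z x) (P x) * Y x k + gval g x (Z x) (P x) * lcCov g X Y x k
      - (gval g x (lcCov g X Y x) (Z x) + gval g x (Y x) (lcCov g X Z x)) * P x k
      + (gval g x (lcCov g Y Z x) (P x) + gval g x (Z x) (P x) * gval g x (Y x) (P x)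
          - gval g x (Y x) (Z x)) * X x k
      - (gval g x (X x) (lcCov g Y Z x) + gval g x (Z x) (P x) * gval g x (X x) (Y x)
          - gval g x (Y x) (Z x) * gval g x (X x) (P x)) * P x k := by
  have h0 : ∀ v, gval g x v (0 : Fin n → ℝ) = 0 := by intro v; simp [gval]
  have e1 : lcCov g X (ssCov g P Y Z) x k = _ :=
    lcCov_comb (g := g) hU X (smooth_lcCov hU hg hgpos hY hZ) hY hP (smooth_gval hg hZ hP)
      (smooth_gval hg hY hZ) hx k
  rw [compat hU hg hgpos hZ hP hx, compat hU hg hgpos hY hZ hx, hpar, h0] at e1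
  have e2 : ssCov g P Y Z x = lcCov g Y Z x + (gval g x (Z x) (P x)) • Y x
      + (- gval g x (Y x) (Z x)) • P x := by
    ext k; simp [ssCov]; ring
  have e3 : ∀ w, gval g x (ssCov g P Y Z x) w = gval g x (lcCov g Y Z x) w
      + gval g x (Z x) (P x) * gval g x (Y x) w - gval g x (Y x) (Z x) * gval g x (P x) w := by
    intro w; rw [e2, gval_add_left, gval_add_left, gval_smul_left, gval_smul_left]; ring
  have c := gval_comm hgpos hx
  have : ssCov g P X (ssCov g P Y Z) x k = lcCov g X (ssCov g P Y Z) x k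
      + gval g x (ssCov g P Y Z x) (P x) * X x k
      - gval g x (X x) (ssCov g P Y Z x) * P x k := rfl
  rw [this, c (X x) (ssCov g P Y Z x), e3, e3, e1, hPunit, c (X x) (lcCov g Y Z x),
    c (X x) (Y x), c (X x) (P x)]
  simp only [Pi.zero_apply]
  ring

lemma curv_ss (hU : IsOpen U) (hg : SmoothVF U g) (hgpos : ∀ x ∈ U, (Matrix.of (g x)).PosDef)
    {P : VF n} (hP : SmoothVF U P) {x : Fin n → ℝ} (hx : x ∈ U)
    (hPunit : gval g x (P x) (P x) = 1)
    (hpar : ∀ X : VF n, SmoothVF U X → lcCov g X P x = 0)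
    {X Y Z : VF n} (hX : SmoothVF U X)
    (hY : SmoothVF U Y) (hZ : SmoothVF U Z) (k : Fin n) :
    curv (ssCov g P) X Y Z x k = curv (lcCov g) X Y Z x k
      + (gval g x (Z x) (P x) * gval g x (Y x) (P x) - gval g x (Y x) (Z x)) * X x k
      - (gval g x (Z x) (P x) * gval g x (X x) (P x) - gval g x (X x) (Z x)) * Y x k
      + (gval g x (Y x) (Z x) * gval g x (X x) (P x)
          - gval g x (X x) (Z x) * gval g x (Y x) (P x)) * P x k := by
  have c := gval_comm hgpos hx
  unfold curv
  rw [ss_ss hU hg hgpos hP hx hPunit (hpar X hX) hY hZ,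
    ss_ss hU hg hgpos hP hx hPunit (hpar Y hY) hX hZ]
  have e : ssCov g P (lie X Y) Z x k = lcCov g (lie X Y) Z x k
      + gval g x (Z x) (P x) * lie X Y x k - gval g x (lie X Y x) (Z x) * P x k := rfl
  have e2 : lie X Y x = lcCov g X Y x + (-1 : ℝ) • lcCov g Y X x := by
    rw [lie_eq hU hgpos X Y hx]; ext k; simp; ring
  rw [e, e2, gval_add_left, gval_smul_left, c (Y x) (X x)]
  simp only [Pi.add_apply, Pi.smul_apply, smul_eq_mul]
  ring

lemma sum_gval_single (x v w : Fin n → ℝ) :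
    ∑ i, gval g x (Pi.single i 1) w * v i = gval g x v w := by
  unfold gval
  refine Finset.sum_congr rfl fun i _ => ?_
  rw [Finset.sum_eq_single i]
  · simp only [Finset.sum_mul, Pi.single_eq_same]
    refine Finset.sum_congr rfl fun j _ => by ring
  · intro b _ hb; simp [hb]
  · simp

lemma ricci_ss (hU : IsOpen U) (hg : SmoothVF U g) (hgpos : ∀ x ∈ U, (Matrix.of (g x)).PosDef)
    {P : VF n} (hP : SmoothVF U P) {x : Fin n → ℝ} (hx : x ∈ U)
    (hPunit : gval g x (P x) (P x) = 1)
    (hpar : ∀ X : VF n, SmoothVF U X → lcCov g X P x = 0)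
    {Y Z : VF n} (hY : SmoothVF U Y) (hZ : SmoothVF U Z) :
    ricci (ssCov g P) Y Z x = ricci (lcCov g) Y Z x
      + ((n : ℝ) - 2) * (gval g x (Y x) (P x) * gval g x (Z x) (P x) - gval g x (Y x) (Z x)) := by
  have c := gval_comm hgpos hx
  have hs := fun i : Fin n => curv_ss hU hg hgpos hP hx hPunit hpar
    (X := fun _ => Pi.single i 1) contDiffOn_const hY hZ i
  have s1 := sum_gval_single (g := g) x (Y x) (P x)
  have s2 := sum_gval_single (g := g) x (Y x) (Z x)
  have s3 := sum_gval_single (g := g) x (P x) (P x)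
  have s4 := sum_gval_single (g := g) x (P x) (Z x)
  unfold ricci
  calc _ = ∑ i, (curv (lcCov g) (fun _ => Pi.single i 1) Y Z x i
        + (gval g x (Z x) (P x) * gval g x (Y x) (P x) - gval g x (Y x) (Z x))
        - gval g x (Z x) (P x) * (gval g x (Pi.single i 1) (P x) * Y x i)
        + gval g x (Pi.single i 1) (Z x) * Y x i
        + gval g x (Y x) (Z x) * (gval g x (Pi.single i 1) (P x) * P x i)
        - gval g x (Y x) (P x) * (gval g x (Pi.single i 1) (Z x) * P x i)) := by
        refine Finset.sum_congr rfl fun i _ => ?_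
        rw [hs i]; simp only [Pi.single_eq_same]; ring
    _ = _ := by
        simp only [Finset.sum_add_distrib, Finset.sum_sub_distrib, ← Finset.mul_sum]
        rw [s1, s2, s3, s4, hPunit, c (P x) (Z x)]
        simp only [Finset.sum_const, Finset.card_univ, Fintype.card_fin, nsmul_eq_mul]
        ring

lemma parallel (hn : 3 ≤ n) (hU : IsOpen U) (hg : SmoothVF U g)
    (hgpos : ∀ x ∈ U, (Matrix.of (g x)).PosDef)
    {P : VF n} (hP : SmoothVF U P)
    (hPunit : ∀ x ∈ U, gval g x (P x) (P x) = 1)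
    (hS : ∀ Y Z : VF n, SmoothVF U Y → SmoothVF U Z → ∀ x ∈ U,
      ricci (lcCov g) Y Z x =
        ((n : ℝ) - 2) * gval g x (Y x) (Z x)
          - ((n : ℝ) - 2) * (gval g x (Y x) (P x) * gval g x (Z x) (P x)))
    (hdS : ∀ X Y Z : VF n, SmoothVF U X → SmoothVF U Y → SmoothVF U Z → ∀ x ∈ U,
      covT (lcCov g) (ricci (lcCov g)) X Y Z x = 0)
    {X : VF n} (hX : SmoothVF U X) {x : Fin n → ℝ} (hx : x ∈ U) : lcCov g X P x = 0 := by
  have c := gval_comm hgpos hx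
  have hn2 : ((n : ℝ) - 2) ≠ 0 := by
    have : (3 : ℝ) ≤ n := by exact_mod_cast hn
    intro h; linarith
  have hY : SmoothVF U (lcCov g X P) := smooth_lcCov hU hg hgpos hX hP
  set Y := lcCov g X P with hYdef
  have h0 : gval g x (Y x) (P x) = 0 := by
    have h := compat hU hg hgpos (X := X) hP hP hx
    have : (fun y => gval g y (P y) (P y)) =ᶠ[nhds x] fun _ => (1 : ℝ) := by
      filter_upwards [hU.mem_nhds hx] with y hy using hPunit y hy
    rw [this.fderiv_eq, c (P x), ← hYdef] at h
    simp at h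
    linarith
  have h1 := hdS X Y P hX hY hP x hx
  have hXY := smooth_lcCov hU hg hgpos hX hY
  unfold covT at h1
  rw [hS _ _ hXY hP x hx, hS Y (lcCov g X P) hY hY x hx] at h1
  have ev : ricci (lcCov g) Y P =ᶠ[nhds x] fun _ => 0 := by
    filter_upwards [hU.mem_nhds hx] with y hy
    rw [hS Y P hY hP y hy, hPunit y hy]; ring
  rw [ev.fderiv_eq, ← hYdef, h0, hPunit x hx] at h1
  apply gval_self_eq_zero hgpos hx
  simp at h1
  rcases h1 with h1 | h1
  · exact absurd h1 hn2
  · exact h1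

end helpers

/-- On an open `U ⊆ ℝⁿ` (`n ≥ 3`) with Riemannian metric `g`, Levi-Civita
connection `∇`, vector field `P`, `π(X) = g(X,P)`, semi-symmetric metric connection `∇̄`,
`S = Ric_∇`, `S̄ = Ric_∇̄`, `Ŝ = sym S̄`: suppose `g(P,P) = 1` everywhere,
`S(Y,Z) = (n−2)g(Y,Z) − (n−2)π(Y)π(Z)` for all vector fields `Y, Z`, and `∇S ≡ 0`.
Then `∇̄Ŝ ≡ 0`, i.e. `(∇̄_X Ŝ)(Y,Z) = 0` for all vector fields `X, Y, Z`. -/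
theorem statement8 (n : ℕ) (hn : 3 ≤ n)
    (U : Set (Fin n → ℝ)) (hU : IsOpen U)
    (g : (Fin n → ℝ) → Fin n → Fin n → ℝ) (hg : SmoothVF U g)
    (hgpos : ∀ x ∈ U, (Matrix.of (g x)).PosDef)
    (P : VF n) (hP : SmoothVF U P)
    (hPunit : ∀ x ∈ U, gval g x (P x) (P x) = 1)
    (hS : ∀ Y Z : VF n, SmoothVF U Y → SmoothVF U Z → ∀ x ∈ U,
      ricci (lcCov g) Y Z x =
        ((n : ℝ) - 2) * gval g x (Y x) (Z x)
          - ((n : ℝ) - 2) * (gval g x (Y x) (P x) * gval g x (Z x) (P x)))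
    (hdS : ∀ X Y Z : VF n, SmoothVF U X → SmoothVF U Y → SmoothVF U Z → ∀ x ∈ U,
      covT (lcCov g) (ricci (lcCov g)) X Y Z x = 0) :
    ∀ X Y Z : VF n, SmoothVF U X → SmoothVF U Y → SmoothVF U Z → ∀ x ∈ U,
      covT (ssCov g P) (shat g P) X Y Z x = 0 := by
  have hz : ∀ Y Z : VF n, SmoothVF U Y → SmoothVF U Z → ∀ x ∈ U, shat g P Y Z x = 0 := by
    intro Y Z hY hZ x hx
    have hpar : ∀ X : VF n, SmoothVF U X → lcCov g X P x = 0 := fun X hX =>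
      parallel hn hU hg hgpos hP hPunit hS hdS hX hx
    unfold shat
    rw [ricci_ss hU hg hgpos hP hx (hPunit x hx) hpar hY hZ,
      ricci_ss hU hg hgpos hP hx (hPunit x hx) hpar hZ hY, hS Y Z hY hZ x hx, hS Z Y hZ hY x hx]
    ring
  intro X Y Z hX hY hZ x hx
  unfold covT
  have ev : shat g P Y Z =ᶠ[nhds x] fun _ => 0 := by
    filter_upwards [hU.mem_nhds hx] with y hy using hz Y Z hY hZ y hy
  rw [ev.fderiv_eq, hz _ _ (smooth_ssCov hU hg hgpos hP hX hY) hZ x hx,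
    hz _ _ hY (smooth_ssCov hU hg hgpos hP hX hZ) x hx]
  simp
end
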